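/- arXiv:1901.02799 — 3 statements merged into one kernel-verified Lean document; each statement's English description precedes it below -/
import Mathlib

section
/- Distributional adjoint identity for Riemann–Liouville derivatives: let a < b be real numbers, let γ > 0 with k−1 < γ ≤ k for an integer k, and let v ∈ L²(a,b). Then for every smooth function φ compactly supported in (a,b), (−1)^k ∫_a^b (D_{a+}^{-(k−γ)} v)(t) φ^{(k)}(t) dt = ∫_a^b v(t) (D_{b−}^{γ} φ)(t) dt, where D_{b−}^{γ} φ := (−1)^k (d/dt)^k (D_{b−}^{-(k−γ)} φ) is computed classically (and D_{b−}^{0} is the identity when γ = k). -/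
open MeasureTheory Set

/-- Left Riemann–Liouville fractional integral of order `γ` (with base point `a`);
`D_{a+}^{0}` is the identity. -/
noncomputable def rlIntL (a γ : ℝ) (v : ℝ → ℝ) (t : ℝ) : ℝ :=
  if γ = 0 then v t
  else (Real.Gamma γ)⁻¹ * ∫ s in a..t, (t - s) ^ (γ - 1) * v s

/-- Right Riemann–Liouville fractional integral of order `γ` (with base point `b`);
`D_{b-}^{0}` is the identity. -/
noncomputable def rlIntR (b γ : ℝ) (v : ℝ → ℝ) (t : ℝ) : ℝ :=
  if γ = 0 then v t
  else (Real.Gamma γ)⁻¹ * ∫ s in t..b, (s - t) ^ (γ - 1) * v s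

/-- The truncated power kernel. -/
noncomputable def rlKer (α L x : ℝ) : ℝ := (Ioo 0 L).indicator (fun y => y ^ (α - 1)) x

lemma rlKer_integrable (α L : ℝ) (hα : 0 < α) (hL : 0 < L) : Integrable (rlKer α L) := by
  unfold rlKer
  rw [integrable_indicator_iff measurableSet_Ioo]
  exact (intervalIntegral.integrableOn_Ioo_rpow_iff hL).2 (by linarith)

lemma rl_iteratedDeriv_conv (k : ℕ) (f : ℝ → ℝ) (hf : LocallyIntegrable f) (φ : ℝ → ℝ)
    (hφ : ContDiff ℝ (⊤ : ℕ∞) φ) (hφc : HasCompactSupport φ) :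
    iteratedDeriv k (convolution f φ (ContinuousLinearMap.mul ℝ ℝ) volume) =
      convolution f (iteratedDeriv k φ) (ContinuousLinearMap.mul ℝ ℝ) volume := by
  induction k generalizing φ with
  | zero => simp
  | succ n ih =>
    have h1 : deriv (convolution f φ (ContinuousLinearMap.mul ℝ ℝ) volume) =
        convolution f (deriv φ) (ContinuousLinearMap.mul ℝ ℝ) volume := by
      funext x
      exact (hφc.hasDerivAt_convolution_right (ContinuousLinearMap.mul ℝ ℝ) hf
        (hφ.of_le (by exact_mod_cast le_top)) x).deriv
    rw [iteratedDeriv_succ', h1, iteratedDeriv_succ']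
    exact ih _ (contDiff_infty_iff_deriv.mp hφ).2 hφc.deriv

lemma rlIntR_eq (a b α : ℝ) (hα : α ≠ 0) (ψ : ℝ → ℝ)
    (hψ : Function.support ψ ⊆ Ioo a b) (t : ℝ) (ht : t ∈ Ioo a b) :
    rlIntR b α ψ t = (Real.Gamma α)⁻¹ * ∫ s, rlKer α (b - a) (s - t) * ψ s := by
  rw [rlIntR, if_neg hα, intervalIntegral.integral_of_le ht.2.le, integral_Ioc_eq_integral_Ioo,
    ← integral_indicator measurableSet_Ioo]
  congr 2
  funext s
  by_cases hs : s ∈ Ioo a b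
  · unfold rlKer
    by_cases h : t < s
    · rw [indicator_of_mem (by exact ⟨h, hs.2⟩), indicator_of_mem]
      exact ⟨by linarith, by linarith [hs.2, ht.1]⟩
    · rw [indicator_of_notMem (by simp [h]), indicator_of_notMem, zero_mul]
      simp only [mem_Ioo, not_and]
      intro h'; linarith
  · have : ψ s = 0 := by
      by_contra h
      exact hs (hψ h)
    simp [indicator, this]

lemma rlIntL_eq (a b α : ℝ) (hα : α ≠ 0) (v : ℝ → ℝ) (t : ℝ) (ht : t ∈ Ioo a b) :
    rlIntL a α v t = (Real.Gamma α)⁻¹ *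
      ∫ s, (Ioo a b).indicator v s * rlKer α (b - a) (t - s) := by
  rw [rlIntL, if_neg hα, intervalIntegral.integral_of_le ht.1.le, integral_Ioc_eq_integral_Ioo,
    ← integral_indicator measurableSet_Ioo]
  congr 2
  funext s
  unfold rlKer
  by_cases hs : s ∈ Ioo a t
  · rw [indicator_of_mem hs, indicator_of_mem (by exact ⟨hs.1, hs.2.trans ht.2⟩),
      indicator_of_mem, mul_comm]
    exact ⟨by linarith [hs.2], by linarith [hs.1, ht.2]⟩
  · rw [indicator_of_notMem hs]
    by_cases h : s ∈ Ioo a b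
    · rw [indicator_of_notMem (a := t - s), mul_zero]
      intro h'
      exact hs ⟨h.1, by linarith [h'.1]⟩
    · rw [indicator_of_notMem h, zero_mul]

lemma rl_fubini (V g ψ : ℝ → ℝ) (hV : Integrable V) (hg : Integrable g)
    (hψ : Continuous ψ) (hψc : HasCompactSupport ψ) :
    ∫ t, (∫ s, V s * g (t - s)) * ψ t = ∫ s, V s * ∫ t, g (t - s) * ψ t := by
  have h1 : Integrable (fun p : ℝ × ℝ => V p.2 * g (p.1 - p.2)) (volume.prod volume) :=
    hV.convolution_integrand (ContinuousLinearMap.mul ℝ ℝ) hg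
  obtain ⟨C, hC⟩ := hψc.exists_bound_of_continuous hψ
  have h2 : Integrable (fun p : ℝ × ℝ => V p.2 * g (p.1 - p.2) * ψ p.1)
      (volume.prod volume) :=
    h1.mul_bdd (c := C) (hψ.comp continuous_fst).aestronglyMeasurable
      (Filter.Eventually.of_forall fun p => hC p.1)
  have h3 := integral_integral_swap (f := fun t s => V s * g (t - s) * ψ t) h2
  simp_rw [integral_mul_const, mul_assoc, integral_const_mul] at h3
  exact h3

/-- Distributional adjoint identity for Riemann–Liouville derivatives: the `k`-th
distributional derivative of `D_{a+}^{-(k-γ)} v`, tested against `φ`, equals the pairing of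
`v` with the classically computed right Riemann–Liouville derivative
`D_{b-}^{γ} φ = (-1)^k (d/dt)^k (D_{b-}^{-(k-γ)} φ)`. -/
theorem stmt3 (a b γ : ℝ) (hab : a < b) (k : ℕ) (hγ : 0 < γ)
    (hk1 : (k : ℝ) - 1 < γ) (hk2 : γ ≤ k)
    (v : ℝ → ℝ) (hv : MemLp v 2 (volume.restrict (Set.Ioo a b)))
    (φ : ℝ → ℝ) (hφ : ContDiff ℝ (⊤ : ℕ∞) φ) (hφc : HasCompactSupport φ)
    (hφs : tsupport φ ⊆ Set.Ioo a b) :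
    (-1 : ℝ) ^ k * ∫ t in Set.Ioo a b, rlIntL a ((k : ℝ) - γ) v t * iteratedDeriv k φ t =
    ∫ t in Set.Ioo a b,
      v t * ((-1 : ℝ) ^ k * iteratedDeriv k (fun s => rlIntR b ((k : ℝ) - γ) φ s) t) := by
  have hsub : Function.support (iteratedDeriv k φ) ⊆ tsupport φ := by
    intro x hx
    apply support_iteratedFDeriv_subset (𝕜 := ℝ) k
    intro h
    apply hx
    rw [iteratedDeriv_eq_iteratedFDeriv, h]
    simp
  have hc : HasCompactSupport (iteratedDeriv k φ) :=
    HasCompactSupport.of_support_subset_isCompact hφc hsub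
  have hcont : Continuous (iteratedDeriv k φ) :=
    hφ.continuous_iteratedDeriv k (by exact_mod_cast le_top)
  obtain ⟨α, hαdef⟩ : ∃ α : ℝ, α = (k : ℝ) - γ := ⟨_, rfl⟩
  rw [← hαdef]
  rcases eq_or_ne α 0 with h0 | h0
  · rw [← integral_const_mul]
    subst h0
    simp only [rlIntL, rlIntR, if_true]
    congr 1
    funext t
    ring
  have hα : 0 < α := lt_of_le_of_ne (by linarith) h0.symm
  have hL : 0 < b - a := by linarith
  have hK := rlKer_integrable α (b - a) hα hL
  have hV : Integrable ((Ioo a b).indicator v) := by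
    rw [integrable_indicator_iff measurableSet_Ioo]
    exact hv.integrable (by norm_num)
  have hR : ∀ t ∈ Ioo a b, iteratedDeriv k (fun s => rlIntR b α φ s) t =
      (Real.Gamma α)⁻¹ * ∫ s, rlKer α (b - a) (s - t) * iteratedDeriv k φ s := by
    intro t ht
    have hconv : ∀ (ψ : ℝ → ℝ) (t : ℝ), ∫ s, rlKer α (b - a) (s - t) * ψ s =
        convolution (fun x => rlKer α (b - a) (-x)) ψ (ContinuousLinearMap.mul ℝ ℝ) volume t := by
      intro ψ t
      rw [convolution_mul_swap]
      simp
    have he : (fun s => rlIntR b α φ s) =ᶠ[nhds t] fun s => (Real.Gamma α)⁻¹ *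
        convolution (fun x => rlKer α (b - a) (-x)) φ (ContinuousLinearMap.mul ℝ ℝ) volume s := by
      filter_upwards [isOpen_Ioo.mem_nhds ht] with s hs
      rw [rlIntR_eq a b α h0 φ ((subset_tsupport φ).trans hφs) s hs, hconv]
    rw [he.iteratedDeriv_eq, iteratedDeriv_const_mul_field, hconv,
      rl_iteratedDeriv_conv k _ hK.comp_neg.locallyIntegrable φ hφ hφc]
  have hF := rl_fubini _ _ _ hV hK hcont hc
  have hl : ∫ t in Ioo a b, rlIntL a α v t * iteratedDeriv k φ t = (Real.Gamma α)⁻¹ *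
      ∫ t, (∫ s, (Ioo a b).indicator v s * rlKer α (b - a) (t - s)) * iteratedDeriv k φ t := by
    rw [← integral_indicator measurableSet_Ioo, ← integral_const_mul]
    congr 1
    funext t
    by_cases ht : t ∈ Ioo a b
    · rw [indicator_of_mem ht, rlIntL_eq a b α h0 v t ht, mul_assoc]
    · have : iteratedDeriv k φ t = 0 := by
        by_contra h
        exact ht (hφs (hsub h))
      simp [this, indicator]
  have hr : ∫ t in Ioo a b, v t * ((-1 : ℝ) ^ k *
      iteratedDeriv k (fun s => rlIntR b α φ s) t) = (-1 : ℝ) ^ k * ((Real.Gamma α)⁻¹ *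
      ∫ s, (Ioo a b).indicator v s *
        ∫ t, rlKer α (b - a) (t - s) * iteratedDeriv k φ t) := by
    rw [← integral_indicator measurableSet_Ioo, ← integral_const_mul, ← integral_const_mul]
    congr 1
    funext t
    by_cases ht : t ∈ Ioo a b
    · rw [indicator_of_mem ht, indicator_of_mem ht, hR t ht]
      ring
    · simp [indicator_of_notMem ht]
  rw [hl, hr, hF]
end

section
/- Coercivity of the pairing of left and right fractional integrals (the paper's coercivity lemma for orders γ = −σ ∈ (−1/2, 0]): let a < b be real numbers, let 0 ≤ σ < 1/2, and let v ∈ L²(a,b). Then cos(σπ) ‖D_{a+}^{-σ} v‖²_{L²(a,b)} ≤ ∫_a^b (D_{a+}^{-σ} v)(t) (D_{b−}^{-σ} v)(t) dt ≤ sec(σπ) ‖D_{a+}^{-σ} v‖²_{L²(a,b)}, and likewise cos(σπ) ‖D_{b−}^{-σ} v‖²_{L²(a,b)} ≤ ∫_a^b (D_{a+}^{-σ} v)(t) (D_{b−}^{-σ} v)(t) dt ≤ sec(σπ) ‖D_{b−}^{-σ} v‖²_{L²(a,b)}. -/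
open MeasureTheory Set

noncomputable def kk (σ x : ℝ) : ℝ := if 0 < x then x ^ (σ - 1) else 0

lemma kk_nonneg (σ x : ℝ) : 0 ≤ kk σ x := by
  unfold kk; split_ifs with h
  · positivity
  · exact le_rfl

lemma kk_meas (σ : ℝ) : Measurable (kk σ) := by
  unfold kk
  exact Measurable.ite measurableSet_Ioi (by fun_prop) measurable_const

lemma kk_scale (σ : ℝ) {c : ℝ} (hc : 0 < c) (x : ℝ) : kk σ (c * x) = c ^ (σ - 1) * kk σ x := by
  unfold kk
  by_cases h : 0 < x
  · rw [if_pos h, if_pos (by positivity), Real.mul_rpow hc.le h.le]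
  · rw [if_neg h, if_neg (by rw [mul_pos_iff_of_pos_left hc]; exact h), mul_zero]

lemma beta_int (α β : ℝ) (hα : 0 < α) (hβ : 0 < β) :
    ∫ x in Ioo (0:ℝ) 1, x ^ (α - 1) * (1 - x) ^ (β - 1) = ProbabilityTheory.beta α β := by
  have h : ((∫ x in Ioo (0:ℝ) 1, x ^ (α - 1) * (1 - x) ^ (β - 1) : ℝ) : ℂ)
      = Complex.betaIntegral α β := by
    rw [Complex.betaIntegral, intervalIntegral.integral_of_le zero_le_one,
      integral_Ioc_eq_integral_Ioo, ← integral_complex_ofReal]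
    refine setIntegral_congr_fun measurableSet_Ioo fun x hx => ?_
    have h1 : 0 ≤ x := hx.1.le
    have h2 : 0 ≤ 1 - x := by linarith [hx.2]
    push_cast [Complex.ofReal_cpow h1, Complex.ofReal_cpow h2]
    rfl
  rw [ProbabilityTheory.beta_eq_betaIntegralReal _ _ hα hβ, ← h, Complex.ofReal_re]

lemma C1_val (σ : ℝ) (h0 : 0 < σ) :
    ∫ u, kk σ u * kk σ (1 - u) = ProbabilityTheory.beta σ σ := by
  rw [← beta_int σ σ h0 h0, ← integral_indicator measurableSet_Ioo]
  congr 1; ext u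
  by_cases hu : u ∈ Ioo (0:ℝ) 1
  · rw [indicator_of_mem hu, kk, kk, if_pos hu.1, if_pos (by linarith [hu.2])]
  · rw [indicator_of_notMem hu, kk, kk]
    simp only [mem_Ioo, not_and_or] at hu
    rcases hu with hu | hu
    · rw [if_neg hu, zero_mul]
    · rw [if_neg (c := 0 < 1 - u) (by linarith), mul_zero]

lemma C2_val (σ : ℝ) (h0 : 0 < σ) (h1 : σ < 1/2) :
    ∫ u, kk σ (u + 1) * kk σ u = ProbabilityTheory.beta (1 - 2 * σ) σ := by
  rw [← beta_int (1 - 2 * σ) σ (by linarith) h0]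
  have himg : Set.image (fun y : ℝ => y⁻¹ - 1) (Ioo 0 1) = Ioi 0 := by
    ext u
    constructor
    · rintro ⟨y, hy, rfl⟩
      have := (one_lt_inv₀ hy.1).2 hy.2
      simp only [mem_Ioi]; linarith
    · intro hu
      have hu : 0 < u := hu
      refine ⟨(u + 1)⁻¹, ⟨by positivity, inv_lt_one_of_one_lt₀ (by linarith)⟩, by simp⟩
  have key := integral_image_eq_integral_abs_deriv_smul (s := Ioo (0:ℝ) 1)
    (f := fun y : ℝ => y⁻¹ - 1) (f' := fun y => -(y ^ 2)⁻¹) measurableSet_Ioo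
    (fun x hx => ((hasDerivAt_inv hx.1.ne').sub_const 1).hasDerivWithinAt)
    (fun x _ y _ h => by simpa using h) (fun u => kk σ (u + 1) * kk σ u)
  rw [himg] at key
  have e : ∫ u, kk σ (u + 1) * kk σ u = ∫ u in Ioi (0:ℝ), kk σ (u + 1) * kk σ u := by
    rw [← integral_indicator measurableSet_Ioi]
    congr 1; ext u
    by_cases hu : u ∈ Ioi (0:ℝ)
    · rw [indicator_of_mem hu]
    · rw [indicator_of_notMem hu]
      have : kk σ u = 0 := if_neg hu
      rw [this, mul_zero]
  rw [e, key]
  refine setIntegral_congr_fun measurableSet_Ioo fun y hy => ?_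
  have hy0 : 0 < y := hy.1
  have hy1 : 0 < 1 - y := by linarith [hy.2]
  have e2 : y⁻¹ - 1 = y⁻¹ * (1 - y) := by field_simp
  simp only [smul_eq_mul, sub_add_cancel, abs_neg]
  rw [e2, kk, kk, if_pos (by positivity), if_pos (by positivity),
    Real.mul_rpow (by positivity) hy1.le, abs_of_pos (by positivity), Real.inv_rpow hy0.le,
    ← Real.rpow_neg hy0.le, ← Real.rpow_natCast, ← Real.rpow_neg hy0.le]
  rw [← mul_assoc, ← mul_assoc, ← Real.rpow_add hy0, ← Real.rpow_add hy0]
  congr 2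
  push_cast; ring

lemma dpow (σ : ℝ) {d : ℝ} (hd : 0 < d) : d * (d ^ (σ - 1) * d ^ (σ - 1)) = d ^ (2 * σ - 1) := by
  nth_rewrite 1 [← Real.rpow_one d]
  rw [← Real.rpow_add hd, ← Real.rpow_add hd]
  congr 1; ring

lemma scale_int (g : ℝ → ℝ) {d : ℝ} (hd : 0 < d) : ∫ x, g x = d * ∫ x, g (d * x) := by
  rw [Measure.integral_comp_mul_left, abs_of_pos (by positivity), smul_eq_mul,
    mul_inv_cancel_left₀ hd.ne']

lemma M1_lt (σ : ℝ) (h0 : 0 < σ) {s r : ℝ} (h : s < r) :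
    ∫ t, kk σ (t - s) * kk σ (r - t) = ProbabilityTheory.beta σ σ * |r - s| ^ (2 * σ - 1) := by
  have hd : 0 < r - s := by linarith
  rw [← integral_add_right_eq_self _ s, scale_int _ hd, abs_of_pos hd, ← dpow σ hd, ← C1_val σ h0,
    mul_comm (∫ u, _), mul_assoc (r - s), ← integral_const_mul (_ * _)]
  congr 1; apply integral_congr_ae; refine .of_forall fun u => ?_
  simp only
  have e1 : (r - s) * u + s - s = (r - s) * u := by ring
  have e2 : r - ((r - s) * u + s) = (r - s) * (1 - u) := by ring
  rw [e1, e2, kk_scale _ hd, kk_scale _ hd]; ring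

lemma M1_ge (σ : ℝ) {s r : ℝ} (h : r ≤ s) (t : ℝ) : kk σ (t - s) * kk σ (r - t) = 0 := by
  unfold kk
  by_cases h1 : 0 < t - s
  · rw [if_neg (c := 0 < r - t) (by linarith), mul_zero]
  · rw [if_neg h1, zero_mul]

lemma M2_lt (σ : ℝ) (h0 : 0 < σ) (h1 : σ < 1/2) {s r : ℝ} (h : s < r) :
    ∫ t, kk σ (t - s) * kk σ (t - r) =
      ProbabilityTheory.beta (1 - 2 * σ) σ * |r - s| ^ (2 * σ - 1) := by
  have hd : 0 < r - s := by linarith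
  rw [← integral_add_right_eq_self _ r, scale_int _ hd, abs_of_pos hd, ← dpow σ hd,
    ← C2_val σ h0 h1, mul_comm (∫ u, _), mul_assoc (r - s), ← integral_const_mul (_ * _)]
  congr 1; apply integral_congr_ae; refine .of_forall fun u => ?_
  simp only
  have e1 : (r - s) * u + r - s = (r - s) * (u + 1) := by ring
  have e2 : (r - s) * u + r - r = (r - s) * u := by ring
  rw [e1, e2, kk_scale _ hd, kk_scale _ hd]; ring

lemma M2_ne (σ : ℝ) (h0 : 0 < σ) (h1 : σ < 1/2) {s r : ℝ} (h : s ≠ r) :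
    ∫ t, kk σ (t - s) * kk σ (t - r) =
      ProbabilityTheory.beta (1 - 2 * σ) σ * |r - s| ^ (2 * σ - 1) := by
  rcases h.lt_or_gt with h | h
  · exact M2_lt σ h0 h1 h
  · rw [abs_sub_comm, ← M2_lt σ h0 h1 h]
    congr 1; ext t; ring

lemma M3_ne (σ : ℝ) (h0 : 0 < σ) (h1 : σ < 1/2) {s r : ℝ} (h : s ≠ r) :
    ∫ t, kk σ (s - t) * kk σ (r - t) =
      ProbabilityTheory.beta (1 - 2 * σ) σ * |r - s| ^ (2 * σ - 1) := by
  have := M2_ne σ h0 h1 (s := -s) (r := -r) (by simpa using h)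
  rw [← integral_neg_eq_self, show |r - s| = |-r - -s| by rw [abs_sub_comm]; ring_nf, ← this]
  congr 1; ext t; ring_nf

lemma beta_rel (σ : ℝ) (h0 : 0 < σ) (h1 : σ < 1/2) :
    ProbabilityTheory.beta σ σ =
      2 * (Real.cos (σ * Real.pi) * ProbabilityTheory.beta (1 - 2 * σ) σ) := by
  have g1 := Real.Gamma_mul_Gamma_one_sub σ
  have g2 := Real.Gamma_mul_Gamma_one_sub (2 * σ)
  have p1 := Real.Gamma_pos_of_pos h0
  have p2 := Real.Gamma_pos_of_pos (s := 2 * σ) (by linarith)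
  have p3 := Real.Gamma_pos_of_pos (s := 1 - σ) (by linarith)
  have hpi := Real.pi_pos
  have s1 : 0 < Real.sin (Real.pi * σ) := Real.sin_pos_of_pos_of_lt_pi (by positivity) (by nlinarith)
  have c1 : 0 < Real.cos (Real.pi * σ) := Real.cos_pos_of_mem_Ioo ⟨by nlinarith, by nlinarith⟩
  rw [show Real.pi * (2 * σ) = 2 * (Real.pi * σ) by ring, Real.sin_two_mul] at g2
  unfold ProbabilityTheory.beta
  rw [show 1 - 2 * σ + σ = 1 - σ by ring, show σ + σ = 2 * σ by ring, mul_comm σ Real.pi]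
  rw [eq_div_iff (by positivity)] at g1 g2
  field_simp
  have : Real.sin (Real.pi * σ) * (Real.Gamma σ * Real.Gamma (1 - σ)) =
    Real.sin (Real.pi * σ) * (Real.Gamma (2 * σ) * (2 * Real.cos (Real.pi * σ) * Real.Gamma (1 - 2 * σ))) := by
    linear_combination g1 - g2
  have := mul_left_cancel₀ s1.ne' this
  rw [mul_comm Real.pi σ] at this
  linear_combination this

lemma hdiag : ∀ᵐ z : ℝ × ℝ ∂(volume.prod volume), z.1 ≠ z.2 := by
    rw [Measure.ae_prod_iff_ae_ae]
    · filter_upwards with x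
      have : ∀ᵐ y : ℝ, y ≠ x := by simp [ae_iff]
      filter_upwards [this] with y hy using hy.symm
    · exact (measurableSet_eq_fun measurable_fst measurable_snd).compl

/-- general Fubini -/
lemma fub (V : ℝ → ℝ) (hV : AEStronglyMeasurable V volume) (p q : ℝ → ℝ → ℝ)
    (hp : Measurable (Function.uncurry p)) (hq : Measurable (Function.uncurry q))
    (p0 : ∀ t s, 0 ≤ p t s) (q0 : ∀ t s, 0 ≤ q t s) (C e : ℝ)
    (hI : ∀ s r, s ≠ r → Integrable (fun t => p t s * q t r))
    (hM : ∀ s r, s ≠ r → ∫ t, p t s * q t r ≤ C * |r - s| ^ e)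
    (hQ : Integrable (fun z : ℝ × ℝ => V z.1 * V z.2 * |z.2 - z.1| ^ e) (volume.prod volume)) :
    Integrable (fun t => (∫ s, p t s * V s) * ∫ r, q t r * V r) ∧
    Integrable (fun z : ℝ × ℝ => V z.1 * V z.2 * ∫ t, p t z.1 * q t z.2) (volume.prod volume) ∧
    ∫ t, (∫ s, p t s * V s) * ∫ r, q t r * V r =
      ∫ z : ℝ × ℝ, V z.1 * V z.2 * ∫ t, p t z.1 * q t z.2 := by
  have hJint : Integrable (fun w : ℝ × (ℝ × ℝ) =>
      (p w.1 w.2.1 * V w.2.1) * (q w.1 w.2.2 * V w.2.2)) (volume.prod (volume.prod volume)) := by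
    have hm : AEStronglyMeasurable (fun w : ℝ × (ℝ × ℝ) =>
      (p w.1 w.2.1 * V w.2.1) * (q w.1 w.2.2 * V w.2.2)) (volume.prod (volume.prod volume)) := by
      have a1 : Measurable fun w : ℝ × (ℝ × ℝ) => p w.1 w.2.1 :=
        hp.comp (measurable_fst.prodMk (measurable_fst.comp measurable_snd))
      have a2 : Measurable fun w : ℝ × (ℝ × ℝ) => q w.1 w.2.2 :=
        hq.comp (measurable_fst.prodMk (measurable_snd.comp measurable_snd))
      exact (a1.aestronglyMeasurable.mul hV.comp_fst.comp_snd).mul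
        (a2.aestronglyMeasurable.mul hV.comp_snd.comp_snd)
    rw [integrable_prod_iff' hm]
    constructor
    · filter_upwards [hdiag] with z hz
      refine ((hI z.1 z.2 hz).const_mul (V z.1 * V z.2)).congr (.of_forall fun t => ?_)
      simp only; ring
    · refine (hQ.norm.const_mul C).mono' hm.norm.prod_swap.integral_prod_right' ?_
      filter_upwards [hdiag] with z hz
      rw [Real.norm_of_nonneg (integral_nonneg fun t => norm_nonneg _)]
      have : ∀ t, ‖p t z.1 * V z.1 * (q t z.2 * V z.2)‖ = |V z.1 * V z.2| * (p t z.1 * q t z.2) := by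
        intro t
        rw [Real.norm_eq_abs, show p t z.1 * V z.1 * (q t z.2 * V z.2) = (V z.1 * V z.2) * (p t z.1 * q t z.2) by ring,
          abs_mul _ (p _ _ * _), abs_of_nonneg (mul_nonneg (p0 _ _) (q0 _ _))]
      simp only [this]
      rw [integral_const_mul, norm_mul, Real.norm_eq_abs, Real.norm_of_nonneg (by positivity)]
      have := mul_le_mul_of_nonneg_left (hM z.1 z.2 hz) (abs_nonneg (V z.1 * V z.2))
      linarith
  have hprod : ∀ t, (∫ z : ℝ × ℝ, (p t z.1 * V z.1) * (q t z.2 * V z.2) ∂(volume.prod volume)) =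
      (∫ s, p t s * V s) * ∫ r, q t r * V r := fun t =>
    integral_prod_mul (fun s => p t s * V s) (fun s => q t s * V s)
  refine ⟨?_, ?_, ?_⟩
  · refine hJint.integral_prod_left.congr (.of_forall fun t => ?_)
    exact hprod t
  · refine hJint.integral_prod_right.congr (.of_forall fun z => ?_)
    simp only
    rw [← integral_const_mul]
    congr 1; ext t; ring
  · simp only [← hprod]
    rw [integral_integral_swap hJint]
    congr 1; ext z
    rw [← integral_const_mul]
    congr 1; ext t; ring

lemma Q_int (a b e : ℝ) (he : -1 < e) (he0 : e ≠ 0) (V : ℝ → ℝ) (hV : MemLp V 2 volume)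
    (hs : ∀ x, x ∉ Ioo a b → V x = 0) :
    Integrable (fun z : ℝ × ℝ => V z.1 * V z.2 * |z.2 - z.1| ^ e) (volume.prod volume) := by
  have hV2 : Integrable (fun x => V x ^ 2) := hV.integrable_sq
  have h1 : Integrable ((Ioo 0 (b - a)).indicator fun x : ℝ => x ^ e) := by
    rw [integrable_indicator_iff measurableSet_Ioo]
    rcases le_or_gt (b - a) 0 with h | h
    · simp [Ioo_eq_empty_of_le h]
    · exact (intervalIntegrable_iff_integrableOn_Ioo_of_le h.le).1
        (intervalIntegral.intervalIntegrable_rpow' he)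
  set h : ℝ → ℝ := fun x => (Ioo 0 (b - a)).indicator (fun x : ℝ => x ^ e) x +
    (Ioo 0 (b - a)).indicator (fun x : ℝ => x ^ e) (-x) with hh
  have hJint : Integrable h := h1.add h1.comp_neg
  have hpos : ∀ x : ℝ, 0 ≤ (Ioo 0 (b - a)).indicator (fun x : ℝ => x ^ e) x := fun x =>
    indicator_nonneg (fun y hy => Real.rpow_nonneg hy.1.le _) _
  have hle : ∀ x, |x| < b - a → |x| ^ e ≤ h x := by
    intro x hx
    rcases lt_trichotomy x 0 with h0 | h0 | h0
    · rw [abs_of_neg h0] at hx ⊢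
      simp only [hh]
      rw [indicator_of_mem (show -x ∈ Ioo 0 (b - a) from ⟨by linarith, hx⟩)]
      linarith [hpos x]
    · subst h0
      simp [Real.zero_rpow he0, hh]
    · rw [abs_of_pos h0] at hx ⊢
      simp only [hh]
      rw [indicator_of_mem (show x ∈ Ioo 0 (b - a) from ⟨by linarith, hx⟩)]
      linarith [hpos (-x)]
  have hev : ∀ x, h (-x) = h x := fun x => by simp only [hh, neg_neg]; ring
  have i1 : Integrable (fun z : ℝ × ℝ => V z.2 ^ 2 * h (z.1 - z.2)) (volume.prod volume) :=
    hV2.convolution_integrand (ContinuousLinearMap.mul ℝ ℝ) hJint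
  have i2 := i1.swap
  refine (i1.add i2).mono' ?_ (.of_forall fun z => ?_)
  · refine (hV.1.comp_fst.mul hV.1.comp_snd).mul ?_
    exact Measurable.aestronglyMeasurable (by fun_prop)
  · simp only [Pi.add_apply, Function.comp, Prod.fst_swap, Prod.snd_swap]
    have hn : ∀ x, 0 ≤ h x := fun x => add_nonneg (hpos _) (hpos _)
    by_cases ha : z.1 ∈ Ioo a b
    · by_cases hb : z.2 ∈ Ioo a b
      · have := hle (z.2 - z.1) (abs_lt.2 ⟨by linarith [ha.1, hb.1, ha.2, hb.2], by linarith [ha.1, hb.1, ha.2, hb.2]⟩)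
        rw [show h (z.1 - z.2) = h (z.2 - z.1) by rw [← hev]; ring_nf]
        rw [norm_mul, Real.norm_of_nonneg (by positivity : 0 ≤ |z.2 - z.1| ^ e), ← add_mul]
        refine mul_le_mul ?_ this (by positivity) (by positivity)
        rw [Real.norm_eq_abs, abs_le]
        constructor <;> nlinarith [sq_nonneg (V z.1 + V z.2), sq_nonneg (V z.1 - V z.2), sq_nonneg (V z.1), sq_nonneg (V z.2)]
      · rw [hs _ hb]; simp only [mul_zero, zero_mul, norm_zero]
        exact add_nonneg (mul_nonneg (by positivity) (hn _)) (mul_nonneg (by positivity) (hn _))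
    · rw [hs _ ha]; simp only [mul_zero, zero_mul, norm_zero]
      exact add_nonneg (mul_nonneg (by positivity) (hn _)) (mul_nonneg (by positivity) (hn _))

lemma main_id (a b σ : ℝ) (h0 : 0 < σ) (h1 : σ < 1/2) (V : ℝ → ℝ) (hV : MemLp V 2 volume)
    (hs : ∀ x, x ∉ Ioo a b → V x = 0) :
    (Integrable fun t => (∫ s, kk σ (t - s) * V s) * ∫ s, kk σ (t - s) * V s) ∧
    (Integrable fun t => (∫ s, kk σ (s - t) * V s) * ∫ s, kk σ (s - t) * V s) ∧
    (Integrable fun t => (∫ s, kk σ (t - s) * V s) * ∫ s, kk σ (s - t) * V s) ∧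
    (∫ t, (∫ s, kk σ (t - s) * V s) * ∫ s, kk σ (s - t) * V s) =
      Real.cos (σ * Real.pi) * ∫ t, (∫ s, kk σ (t - s) * V s) * ∫ s, kk σ (t - s) * V s ∧
    (∫ t, (∫ s, kk σ (t - s) * V s) * ∫ s, kk σ (s - t) * V s) =
      Real.cos (σ * Real.pi) * ∫ t, (∫ s, kk σ (s - t) * V s) * ∫ s, kk σ (s - t) * V s := by
  have hQ := Q_int a b (2 * σ - 1) (by linarith) (by linarith) V hV hs
  have mL : Measurable (Function.uncurry fun t s => kk σ (t - s)) :=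
    (kk_meas σ).comp (measurable_fst.sub measurable_snd)
  have mR : Measurable (Function.uncurry fun t s => kk σ (s - t)) :=
    (kk_meas σ).comp (measurable_snd.sub measurable_fst)
  have b1 : 0 < ProbabilityTheory.beta σ σ := ProbabilityTheory.beta_pos h0 h0
  have b2 : 0 < ProbabilityTheory.beta (1 - 2 * σ) σ :=
    ProbabilityTheory.beta_pos (by linarith) h0
  have dp : ∀ s r : ℝ, s ≠ r → 0 < |r - s| ^ (2 * σ - 1) := fun s r h =>
    Real.rpow_pos_of_pos (abs_pos.2 (sub_ne_zero.2 h.symm)) _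
  obtain ⟨iLL, -, eLL⟩ := fub V hV.1 (fun t s => kk σ (t - s)) (fun t s => kk σ (t - s)) mL mL
    (fun _ _ => kk_nonneg _ _) (fun _ _ => kk_nonneg _ _) _ (2 * σ - 1)
    (fun s r h => .of_integral_ne_zero (by
      rw [M2_ne σ h0 h1 h]; exact (mul_pos b2 (dp s r h)).ne'))
    (fun s r h => (M2_ne σ h0 h1 h).le) hQ
  obtain ⟨iRR, -, eRR⟩ := fub V hV.1 (fun t s => kk σ (s - t)) (fun t s => kk σ (s - t)) mR mR
    (fun _ _ => kk_nonneg _ _) (fun _ _ => kk_nonneg _ _) _ (2 * σ - 1)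
    (fun s r h => .of_integral_ne_zero (by
      rw [M3_ne σ h0 h1 h]; exact (mul_pos b2 (dp s r h)).ne'))
    (fun s r h => (M3_ne σ h0 h1 h).le) hQ
  obtain ⟨iLR, jLR, eLR⟩ := fub V hV.1 (fun t s => kk σ (t - s)) (fun t s => kk σ (s - t)) mL mR
    (fun _ _ => kk_nonneg _ _) (fun _ _ => kk_nonneg _ _) (ProbabilityTheory.beta σ σ) (2 * σ - 1)
    (fun s r h => by
      rcases h.lt_or_gt with hlt | hlt
      · exact .of_integral_ne_zero (by
          rw [M1_lt σ h0 hlt]; exact (mul_pos b1 (dp s r h)).ne')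
      · simp only [M1_ge σ hlt.le]; exact integrable_zero _ _ _)
    (fun s r h => by
      rcases h.lt_or_gt with hlt | hlt
      · exact (M1_lt σ h0 hlt).le
      · simp only [M1_ge σ hlt.le, integral_zero]; exact (mul_pos b1 (dp s r h)).le) hQ
  set Q := ∫ z : ℝ × ℝ, V z.1 * V z.2 * |z.2 - z.1| ^ (2 * σ - 1) ∂(volume.prod volume) with hQdef
  have qLL : (∫ z : ℝ × ℝ, V z.1 * V z.2 * ∫ t, kk σ (t - z.1) * kk σ (t - z.2)) =
      ProbabilityTheory.beta (1 - 2 * σ) σ * Q := by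
    rw [hQdef, ← integral_const_mul]
    refine integral_congr_ae ?_
    filter_upwards [hdiag] with z hz
    rw [M2_ne σ h0 h1 hz]; ring
  have qRR : (∫ z : ℝ × ℝ, V z.1 * V z.2 * ∫ t, kk σ (z.1 - t) * kk σ (z.2 - t)) =
      ProbabilityTheory.beta (1 - 2 * σ) σ * Q := by
    rw [hQdef, ← integral_const_mul]
    refine integral_congr_ae ?_
    filter_upwards [hdiag] with z hz
    rw [M3_ne σ h0 h1 hz]; ring
  have qLR : 2 * (∫ z : ℝ × ℝ, V z.1 * V z.2 * ∫ t, kk σ (t - z.1) * kk σ (z.2 - t)) =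
      ProbabilityTheory.beta σ σ * Q := by
    rw [hQdef, ← integral_const_mul (ProbabilityTheory.beta σ σ), two_mul (∫ z : ℝ × ℝ, _)]
    have sw := integral_prod_swap (μ := (volume : Measure ℝ)) (ν := (volume : Measure ℝ))
      (fun z : ℝ × ℝ => V z.1 * V z.2 * ∫ t, kk σ (t - z.1) * kk σ (z.2 - t))
    have jsw := jLR.swap
    rw [← Measure.volume_eq_prod] at sw jLR jsw
    nth_rewrite 1 [← sw]
    rw [← Measure.volume_eq_prod]
    refine (integral_add jsw jLR).symm.trans (integral_congr_ae ?_)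
    have hd := hdiag
    rw [← Measure.volume_eq_prod] at hd
    filter_upwards [hd] with z hz
    simp only [Function.comp, Prod.fst_swap, Prod.snd_swap]
    rcases hz.lt_or_gt with h | h
    · simp only [M1_ge σ h.le, integral_zero]
      rw [M1_lt σ h0 h]; ring
    · simp only [M1_ge σ h.le, integral_zero]
      rw [M1_lt σ h0 h, abs_sub_comm]; ring
  have br := beta_rel σ h0 h1
  refine ⟨iLL, iRR, iLR, ?_, ?_⟩
  · rw [eLL, eLR, qLL]
    rw [br] at qLR; linarith
  · rw [eRR, eLR, qRR]
    rw [br] at qLR; linarith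

lemma rlL_eq (a b σ : ℝ) (h0 : 0 < σ) (v : ℝ → ℝ) (t : ℝ) (ht : t ∈ Ioo a b) :
    rlIntL a σ v t = (Real.Gamma σ)⁻¹ * ∫ s, kk σ (t - s) * (Ioo a b).indicator v s := by
  rw [rlIntL, if_neg h0.ne', intervalIntegral.integral_of_le ht.1.le,
    integral_Ioc_eq_integral_Ioo, ← integral_indicator measurableSet_Ioo]
  congr 2; ext s
  by_cases hs : s ∈ Ioo a t
  · rw [indicator_of_mem hs, indicator_of_mem (show s ∈ Ioo a b from ⟨hs.1, hs.2.trans ht.2⟩), kk,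
      if_pos (by linarith [hs.2])]
  · rw [indicator_of_notMem hs]
    simp only [mem_Ioo, not_and_or, not_lt] at hs
    rcases hs with hs | hs
    · rw [indicator_of_notMem (fun h => by linarith [h.1]), mul_zero]
    · rw [kk, if_neg (by linarith), zero_mul]

lemma rlR_eq (a b σ : ℝ) (h0 : 0 < σ) (v : ℝ → ℝ) (t : ℝ) (ht : t ∈ Ioo a b) :
    rlIntR b σ v t = (Real.Gamma σ)⁻¹ * ∫ s, kk σ (s - t) * (Ioo a b).indicator v s := by
  rw [rlIntR, if_neg h0.ne', intervalIntegral.integral_of_le ht.2.le,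
    integral_Ioc_eq_integral_Ioo, ← integral_indicator measurableSet_Ioo]
  congr 2; ext s
  by_cases hs : s ∈ Ioo t b
  · rw [indicator_of_mem hs, indicator_of_mem (show s ∈ Ioo a b from ⟨ht.1.trans hs.1, hs.2⟩), kk,
      if_pos (by linarith [hs.1])]
  · rw [indicator_of_notMem hs]
    simp only [mem_Ioo, not_and_or, not_lt] at hs
    rcases hs with hs | hs
    · rw [kk, if_neg (by linarith), zero_mul]
    · rw [indicator_of_notMem (fun h => by linarith [h.2]), mul_zero]

/-- Coercivity of the pairing of left and right Riemann–Liouville fractional integrals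
of order `σ ∈ [0, 1/2)`. -/
theorem stmt6 (a b σ : ℝ) (hab : a < b) (hσ0 : 0 ≤ σ) (hσ : σ < 1 / 2)
    (v : ℝ → ℝ) (hv : MemLp v 2 (volume.restrict (Set.Ioo a b))) :
    (Real.cos (σ * Real.pi) * ∫ t in Set.Ioo a b, (rlIntL a σ v t) ^ 2 ≤
        ∫ t in Set.Ioo a b, rlIntL a σ v t * rlIntR b σ v t ∧
      ∫ t in Set.Ioo a b, rlIntL a σ v t * rlIntR b σ v t ≤
        (Real.cos (σ * Real.pi))⁻¹ * ∫ t in Set.Ioo a b, (rlIntL a σ v t) ^ 2) ∧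
    (Real.cos (σ * Real.pi) * ∫ t in Set.Ioo a b, (rlIntR b σ v t) ^ 2 ≤
        ∫ t in Set.Ioo a b, rlIntL a σ v t * rlIntR b σ v t ∧
      ∫ t in Set.Ioo a b, rlIntL a σ v t * rlIntR b σ v t ≤
        (Real.cos (σ * Real.pi))⁻¹ * ∫ t in Set.Ioo a b, (rlIntR b σ v t) ^ 2) := by
  rcases hσ0.eq_or_lt with h0 | h0
  · subst h0
    simp [rlIntL, rlIntR, sq]
  have hV : MemLp ((Ioo a b).indicator v) 2 volume :=
    (memLp_indicator_iff_restrict measurableSet_Ioo).2 hv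
  obtain ⟨iLL, iRR, iLR, eL, eR⟩ := main_id a b σ h0 hσ _ hV
    (fun x hx => indicator_of_notMem hx v)
  have hpi := Real.pi_pos
  have hc : 0 < Real.cos (σ * Real.pi) := Real.cos_pos_of_mem_Ioo ⟨by nlinarith, by nlinarith⟩
  set c := Real.cos (σ * Real.pi)
  set g := (Real.Gamma σ)⁻¹ with hg
  set A : ℝ → ℝ := fun t => ∫ s, kk σ (t - s) * (Ioo a b).indicator v s with hA
  set B : ℝ → ℝ := fun t => ∫ s, kk σ (s - t) * (Ioo a b).indicator v s with hB
  have rL : ∫ t in Ioo a b, (rlIntL a σ v t) ^ 2 = g ^ 2 * ∫ t in Ioo a b, A t * A t := by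
    rw [← integral_const_mul]
    refine setIntegral_congr_fun measurableSet_Ioo fun t ht => ?_
    simp only [rlL_eq a b σ h0 v t ht, hA, hg]; ring
  have rR : ∫ t in Ioo a b, (rlIntR b σ v t) ^ 2 = g ^ 2 * ∫ t in Ioo a b, B t * B t := by
    rw [← integral_const_mul]
    refine setIntegral_congr_fun measurableSet_Ioo fun t ht => ?_
    simp only [rlR_eq a b σ h0 v t ht, hB, hg]; ring
  have rLR : ∫ t in Ioo a b, rlIntL a σ v t * rlIntR b σ v t =
      g ^ 2 * ∫ t in Ioo a b, A t * B t := by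
    rw [← integral_const_mul]
    refine setIntegral_congr_fun measurableSet_Ioo fun t ht => ?_
    simp only [rlL_eq a b σ h0 v t ht, rlR_eq a b σ h0 v t ht, hA, hB, hg]; ring
  have eLR : ∫ t in Ioo a b, A t * B t = ∫ t, A t * B t := by
    refine setIntegral_eq_integral_of_forall_compl_eq_zero fun t ht => ?_
    simp only [mem_Ioo, not_and_or, not_lt] at ht
    rcases ht with ht | ht
    · have : A t = 0 := by
        refine (integral_congr_ae (.of_forall fun s => ?_)).trans (integral_zero ℝ ℝ)
        by_cases hs : s ∈ Ioo a b
        · simp only [kk]; rw [if_neg (by linarith [hs.1]), zero_mul]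
        · simp only [indicator_of_notMem hs, mul_zero]
      rw [this, zero_mul]
    · have : B t = 0 := by
        refine (integral_congr_ae (.of_forall fun s => ?_)).trans (integral_zero ℝ ℝ)
        by_cases hs : s ∈ Ioo a b
        · simp only [kk]; rw [if_neg (by linarith [hs.2]), zero_mul]
        · simp only [indicator_of_notMem hs, mul_zero]
      rw [this, mul_zero]
  have lL : ∫ t in Ioo a b, A t * A t ≤ ∫ t, A t * A t :=
    setIntegral_le_integral iLL (.of_forall fun t => mul_self_nonneg _)
  have lR : ∫ t in Ioo a b, B t * B t ≤ ∫ t, B t * B t :=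
    setIntegral_le_integral iRR (.of_forall fun t => mul_self_nonneg _)
  have cL : c * ∫ t in Ioo a b, A t * A t ≤ ∫ t in Ioo a b, A t * B t := by
    rw [eLR, eL]; exact mul_le_mul_of_nonneg_left lL hc.le
  have cR : c * ∫ t in Ioo a b, B t * B t ≤ ∫ t in Ioo a b, A t * B t := by
    rw [eLR, eR]; exact mul_le_mul_of_nonneg_left lR hc.le
  have y1 : 2 * ∫ t in Ioo a b, A t * B t ≤
      c⁻¹ * (∫ t in Ioo a b, A t * A t) + c * ∫ t in Ioo a b, B t * B t := by
    rw [← integral_const_mul, ← integral_const_mul, ← integral_const_mul, ← integral_add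
      (iLL.integrableOn.const_mul _) (iRR.integrableOn.const_mul _)]
    refine integral_mono (iLR.integrableOn.const_mul _)
      ((iLL.integrableOn.const_mul _).add (iRR.integrableOn.const_mul _)) fun t => ?_
    have : c⁻¹ * (A t * A t) + c * (B t * B t) - 2 * (A t * B t) = c⁻¹ * (A t - c * B t) ^ 2 := by
      field_simp; ring
    have h2 : 0 ≤ c⁻¹ * (A t - c * B t) ^ 2 := by positivity
    simp only; linarith
  have y2 : 2 * ∫ t in Ioo a b, A t * B t ≤
      c * (∫ t in Ioo a b, A t * A t) + c⁻¹ * ∫ t in Ioo a b, B t * B t := by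
    rw [← integral_const_mul, ← integral_const_mul, ← integral_const_mul, ← integral_add
      (iLL.integrableOn.const_mul _) (iRR.integrableOn.const_mul _)]
    refine integral_mono (iLR.integrableOn.const_mul _)
      ((iLL.integrableOn.const_mul _).add (iRR.integrableOn.const_mul _)) fun t => ?_
    have : c * (A t * A t) + c⁻¹ * (B t * B t) - 2 * (A t * B t) = c⁻¹ * (B t - c * A t) ^ 2 := by
      field_simp; ring
    have h2 : 0 ≤ c⁻¹ * (B t - c * A t) ^ 2 := by positivity
    simp only; linarith
  rw [rL, rR, rLR, mul_left_comm c, mul_left_comm c⁻¹, mul_left_comm c, mul_left_comm c⁻¹]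
  have hg2 : 0 ≤ g ^ 2 := sq_nonneg g
  refine ⟨⟨mul_le_mul_of_nonneg_left cL hg2, mul_le_mul_of_nonneg_left (by linarith) hg2⟩,
    mul_le_mul_of_nonneg_left cR hg2, mul_le_mul_of_nonneg_left (by linarith) hg2⟩
end

section
/- Inversion of the Riemann–Liouville derivative (the core identity of the paper's Lemmas 3.5 and 3.6): let a < b be real numbers, let 0 < γ < 1, and let v, g ∈ L²(a,b). If (D_{a+}^{-(1−γ)} v)(t) = ∫_a^t g(s) ds for almost every t ∈ (a,b) (that is, the Riemann–Liouville derivative D_{a+}^{γ} v equals g), then v(t) = (D_{a+}^{-γ} g)(t) for almost every t ∈ (a,b). -/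
open MeasureTheory Set

lemma beta_real (α β r t : ℝ) (hα : 0 < α) (hβ : 0 < β) (hrt : r < t) :
    ∫ s in r..t, (t - s) ^ (α - 1) * (s - r) ^ (β - 1) =
      (t - r) ^ (α + β - 1) * (Real.Gamma α * Real.Gamma β / Real.Gamma (α + β)) := by
  have hL : 0 < t - r := sub_pos.2 hrt
  have h1 := intervalIntegral.integral_comp_sub_right (a := r) (b := t)
    (fun x : ℝ => (t - r - x) ^ (α - 1) * x ^ (β - 1)) r
  have h2 : ∫ s in r..t, (t - s) ^ (α - 1) * (s - r) ^ (β - 1) =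
      ∫ x in (0:ℝ)..(t - r), (t - r - x) ^ (α - 1) * x ^ (β - 1) := by
    rw [sub_self] at h1
    rw [← h1]
    simp
  rw [h2]
  have h3 := Complex.betaIntegral_scaled (β : ℂ) (α : ℂ) hL
  have h4 : (Complex.betaIntegral (β : ℂ) (α : ℂ)) =
      ((Real.Gamma α * Real.Gamma β / Real.Gamma (α + β) : ℝ) : ℂ) := by
    rw [Complex.betaIntegral_eq_Gamma_mul_div]
    · rw [← Complex.ofReal_add, Complex.Gamma_ofReal, Complex.Gamma_ofReal, Complex.Gamma_ofReal,
        add_comm β α, mul_comm (Real.Gamma α)]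
      norm_cast
    all_goals simpa
  rw [h4] at h3
  have h5 : ∫ x in (0:ℝ)..(t - r), (x : ℂ) ^ ((β : ℂ) - 1) * (((t - r : ℝ) : ℂ) - x) ^ ((α : ℂ) - 1)
      = ((∫ x in (0:ℝ)..(t - r), (t - r - x) ^ (α - 1) * x ^ (β - 1) : ℝ) : ℂ) := by
    rw [← intervalIntegral.integral_ofReal]
    apply intervalIntegral.integral_congr
    intro x hx
    rw [uIcc_of_le hL.le] at hx
    have e1 : (x : ℂ) ^ ((β : ℂ) - 1) = ((x ^ (β - 1) : ℝ) : ℂ) := by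
      rw [Complex.ofReal_cpow hx.1]; simp
    have e2 : (((t - r : ℝ) : ℂ) - x) ^ ((α : ℂ) - 1) = (((t - r - x) ^ (α - 1) : ℝ) : ℂ) := by
      rw [Complex.ofReal_cpow (by linarith [hx.2])]; simp
    simp only [e1, e2]
    push_cast
    ring
  rw [h5] at h3
  have h6 : ((t - r : ℝ) : ℂ) ^ ((β : ℂ) + α - 1) = (((t - r) ^ (α + β - 1) : ℝ) : ℂ) := by
    rw [Complex.ofReal_cpow hL.le, add_comm (β : ℂ)]; simp
  rw [h6] at h3
  exact_mod_cast h3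

lemma beta_integrable (α β r t : ℝ) (hα : 0 < α) (hβ : 0 < β) (hrt : r < t) :
    IntervalIntegrable (fun s => (t - s) ^ (α - 1) * (s - r) ^ (β - 1)) volume r t := by
  apply intervalIntegral.intervalIntegrable_of_integral_ne_zero
  rw [beta_real α β r t hα hβ hrt]
  have := Real.Gamma_pos_of_pos hα
  have := Real.Gamma_pos_of_pos hβ
  have := Real.Gamma_pos_of_pos (add_pos hα hβ)
  have := Real.rpow_pos_of_pos (sub_pos.2 hrt) (α + β - 1)
  positivity

/-- the kernel on the triangle -/
noncomputable def triK (α β t : ℝ) (v : ℝ → ℝ) (s r : ℝ) : ℝ :=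
  (Ioi r).indicator (fun s => (t - s) ^ (α - 1) * (s - r) ^ (β - 1)) s * v r

lemma triK_eq (α β t : ℝ) (v : ℝ → ℝ) (s r : ℝ) :
    triK α β t v s r = (t - s) ^ (α - 1) * (Iio s).indicator (fun r => (s - r) ^ (β - 1) * v r) r := by
  unfold triK
  by_cases h : r < s
  · rw [indicator_of_mem (show s ∈ Ioi r from h), indicator_of_mem (show r ∈ Iio s from h)]; ring
  · rw [indicator_of_notMem (show s ∉ Ioi r from h), indicator_of_notMem (show r ∉ Iio s from h)]
    simp

lemma restr_left (a t r : ℝ) (hr : r ∈ Ioo a t) : Ioi r ∩ Ioo a t = Ioo r t := by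
  ext x; simp only [mem_inter_iff, mem_Ioi, mem_Ioo] at *; constructor
  · rintro ⟨h1, h2, h3⟩; exact ⟨h1, h3⟩
  · rintro ⟨h1, h3⟩; exact ⟨h1, hr.1.trans h1, h3⟩

lemma restr_right (a t s : ℝ) (hs : s ∈ Ioo a t) : Iio s ∩ Ioo a t = Ioo a s := by
  ext x; simp only [mem_inter_iff, mem_Iio, mem_Ioo] at *; constructor
  · rintro ⟨h1, h2, h3⟩; exact ⟨h2, h1⟩
  · rintro ⟨h1, h3⟩; exact ⟨h3, h1, h3.trans hs.2⟩

lemma ind_int (α β a t r : ℝ) (hα : 0 < α) (hβ : 0 < β) (hr : r ∈ Ioo a t) :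
    Integrable ((Ioi r).indicator (fun s => (t - s) ^ (α - 1) * (s - r) ^ (β - 1)))
      (volume.restrict (Ioo a t)) := by
  rw [integrable_indicator_iff measurableSet_Ioi, IntegrableOn,
    Measure.restrict_restrict measurableSet_Ioi, restr_left a t r hr]
  exact (intervalIntegrable_iff_integrableOn_Ioo_of_le hr.2.le).1 (beta_integrable α β r t hα hβ hr.2)

lemma ind_val (α β a t r : ℝ) (hα : 0 < α) (hβ : 0 < β) (hr : r ∈ Ioo a t) :
    ∫ s in Ioo a t, (Ioi r).indicator (fun s => (t - s) ^ (α - 1) * (s - r) ^ (β - 1)) s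
      = (t - r) ^ (α + β - 1) * (Real.Gamma α * Real.Gamma β / Real.Gamma (α + β)) := by
  rw [integral_indicator measurableSet_Ioi,
    Measure.restrict_restrict measurableSet_Ioi, restr_left a t r hr, ← integral_Ioc_eq_integral_Ioo,
    ← intervalIntegral.integral_of_le hr.2.le, beta_real α β r t hα hβ hr.2]

lemma pow_int (α a t : ℝ) (hα : 1 ≤ α) (v : ℝ → ℝ)
    (hv : Integrable v (volume.restrict (Ioo a t))) (C : ℝ) :
    Integrable (fun r => (t - r) ^ (α - 1) * C * v r) (volume.restrict (Ioo a t)) := by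
  refine hv.bdd_mul (c := (t - a) ^ (α - 1) * |C|) (by
    apply Measurable.aestronglyMeasurable; fun_prop) ?_
  filter_upwards [ae_restrict_mem measurableSet_Ioo] with r hr
  rw [norm_mul, Real.norm_eq_abs, Real.norm_eq_abs,
    abs_of_nonneg (Real.rpow_nonneg (by linarith [hr.2]) _)]
  gcongr
  · linarith [hr.2]
  · exact hr.1.le

lemma triK_integrable (α β a t : ℝ) (hα : 0 < α) (hβ : 0 < β) (hαβ : 1 ≤ α + β) (v : ℝ → ℝ)
    (hv : Integrable v (volume.restrict (Ioo a t))) :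
    Integrable (Function.uncurry (triK α β t v))
      ((volume.restrict (Ioo a t)).prod (volume.restrict (Ioo a t))) := by
  have hm : AEStronglyMeasurable (Function.uncurry (triK α β t v))
      ((volume.restrict (Ioo a t)).prod (volume.restrict (Ioo a t))) := by
    have : Function.uncurry (triK α β t v) = fun p : ℝ × ℝ =>
        ({p : ℝ × ℝ | p.2 < p.1}.indicator
          (fun p => (t - p.1) ^ (α - 1) * (p.1 - p.2) ^ (β - 1)) p) * v p.2 := by
      ext ⟨s, r⟩
      simp [Function.uncurry, triK, indicator]
    rw [this]
    refine AEStronglyMeasurable.mul ?_ hv.aestronglyMeasurable.comp_snd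
    apply Measurable.aestronglyMeasurable
    exact Measurable.indicator (by fun_prop) (measurableSet_lt measurable_snd measurable_fst)
  rw [integrable_prod_iff' hm]
  constructor
  · filter_upwards [ae_restrict_mem measurableSet_Ioo] with r hr
    exact (ind_int α β a t r hα hβ hr).mul_const (v r)
  · refine (pow_int (α + β) a t hαβ _ hv.norm
      (Real.Gamma α * Real.Gamma β / Real.Gamma (α + β))).congr ?_
    filter_upwards [ae_restrict_mem measurableSet_Ioo] with r hr
    rw [← ind_val α β a t r hα hβ hr, ← integral_mul_const]
    apply integral_congr_ae
    filter_upwards [ae_restrict_mem measurableSet_Ioo] with s hs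
    simp only [Function.uncurry, triK, norm_mul]
    congr 1
    rw [Real.norm_eq_abs, abs_of_nonneg]
    by_cases hrs : r < s
    · rw [indicator_of_mem (show s ∈ Ioi r from hrs)]
      exact mul_nonneg (Real.rpow_nonneg (sub_pos.2 hs.2).le _)
        (Real.rpow_nonneg (sub_pos.2 hrs).le _)
    · rw [indicator_of_notMem (show s ∉ Ioi r from hrs)]

lemma inner_eq (α β a t : ℝ) (hβ : 0 < β) (v : ℝ → ℝ) (s : ℝ) (hs : s ∈ Ioo a t) :
    ∫ r in Ioo a t, triK α β t v s r =
      (t - s) ^ (α - 1) * (Real.Gamma β * rlIntL a β v s) := by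
  simp_rw [triK_eq]
  rw [integral_const_mul, integral_indicator measurableSet_Iio,
    Measure.restrict_restrict measurableSet_Iio, restr_right a t s hs,
    ← integral_Ioc_eq_integral_Ioo, ← intervalIntegral.integral_of_le hs.1.le, rlIntL,
    if_neg hβ.ne', mul_inv_cancel_left₀ (Real.Gamma_pos_of_pos hβ).ne']

lemma semigroup (α β a t : ℝ) (hα : 0 < α) (hβ : 0 < β) (hαβ : 1 ≤ α + β) (hat : a < t) (v : ℝ → ℝ)
    (hv : Integrable v (volume.restrict (Ioo a t))) :
    rlIntL a α (rlIntL a β v) t = rlIntL a (α + β) v t := by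
  have hsw := integral_integral_swap (triK_integrable α β a t hα hβ hαβ v hv)
  have h1 : ∫ s in Ioo a t, ∫ r in Ioo a t, triK α β t v s r =
      Real.Gamma β * ∫ s in Ioo a t, (t - s) ^ (α - 1) * rlIntL a β v s := by
    rw [← integral_const_mul]
    apply setIntegral_congr_fun measurableSet_Ioo
    intro s hs
    simp only
    rw [inner_eq α β a t hβ v s hs]; ring
  have h2 : ∫ r in Ioo a t, ∫ s in Ioo a t, triK α β t v s r =
      (Real.Gamma α * Real.Gamma β / Real.Gamma (α + β)) *
        ∫ r in Ioo a t, (t - r) ^ (α + β - 1) * v r := by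
    rw [← integral_const_mul]
    apply setIntegral_congr_fun measurableSet_Ioo
    intro r hr
    simp only [triK]
    rw [integral_mul_const, ind_val α β a t r hα hβ hr]; ring
  rw [h1, h2] at hsw
  have g1 := Real.Gamma_pos_of_pos hα
  have g2 := Real.Gamma_pos_of_pos hβ
  have g3 := Real.Gamma_pos_of_pos (add_pos hα hβ)
  rw [rlIntL, if_neg hα.ne', rlIntL, if_neg (by positivity), intervalIntegral.integral_of_le hat.le,
    intervalIntegral.integral_of_le hat.le, integral_Ioc_eq_integral_Ioo,
    integral_Ioc_eq_integral_Ioo]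
  field_simp at hsw ⊢
  linarith

lemma rl_one (a t : ℝ) (v : ℝ → ℝ) : rlIntL a 1 v t = ∫ s in a..t, v s := by
  simp [rlIntL]

lemma rl_congr (α a b t : ℝ) (v w : ℝ → ℝ) (ht : t ∈ Ioo a b) (hα : α ≠ 0)
    (h : ∀ᵐ s ∂(volume.restrict (Ioo a b)), v s = w s) : rlIntL a α v t = rlIntL a α w t := by
  rw [rlIntL, if_neg hα, rlIntL, if_neg hα]
  congr 1
  rw [intervalIntegral.integral_of_le ht.1.le, intervalIntegral.integral_of_le ht.1.le,
    integral_Ioc_eq_integral_Ioo, integral_Ioc_eq_integral_Ioo]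
  apply integral_congr_ae
  filter_upwards [ae_restrict_of_ae_restrict_of_subset (Ioo_subset_Ioo_right ht.2.le) h] with s hs
  rw [hs]

lemma rl_integrable (γ a b : ℝ) (hγ : 0 < γ) (g : ℝ → ℝ)
    (hg : Integrable g (volume.restrict (Ioo a b))) :
    Integrable (rlIntL a γ g) (volume.restrict (Ioo a b)) := by
  have h := (triK_integrable 1 γ a b one_pos hγ (by linarith) g hg).integral_prod_left
  refine (h.const_mul (Real.Gamma γ)⁻¹).congr ?_
  filter_upwards [ae_restrict_mem measurableSet_Ioo] with s hs
  simp only [Function.uncurry]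
  rw [inner_eq 1 γ a b hγ g s hs]
  have := Real.Gamma_pos_of_pos hγ
  simp; field_simp

/-- Inversion of the Riemann–Liouville derivative: if `D_{a+}^{γ} v = g` in the sense that
`D_{a+}^{-(1-γ)} v` is the primitive of `g` vanishing at `a`, then `v = D_{a+}^{-γ} g`
almost everywhere on `(a,b)`. -/
theorem stmt8 (a b γ : ℝ) (hab : a < b) (hγ0 : 0 < γ) (hγ1 : γ < 1)
    (v g : ℝ → ℝ)
    (hv : MemLp v 2 (volume.restrict (Set.Ioo a b)))
    (hg : MemLp g 2 (volume.restrict (Set.Ioo a b)))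
    (h : ∀ᵐ t ∂(volume.restrict (Set.Ioo a b)),
      rlIntL a (1 - γ) v t = ∫ s in a..t, g s) :
    ∀ᵐ t ∂(volume.restrict (Set.Ioo a b)), v t = rlIntL a γ g t := by
  have hvi : Integrable v (volume.restrict (Ioo a b)) := hv.integrable (by norm_num)
  have hgi : Integrable g (volume.restrict (Ioo a b)) := hg.integrable (by norm_num)
  have hwi := rl_integrable γ a b hγ0 g hgi
  have key : ∀ t ∈ Ioo a b, ∫ s in a..t, v s = ∫ s in a..t, rlIntL a γ g s := by
    intro t ht
    have hsub : Ioo a t ⊆ Ioo a b := Ioo_subset_Ioo_right ht.2.le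
    have hv' : Integrable v (volume.restrict (Ioo a t)) :=
      hvi.mono_measure (Measure.restrict_mono_set _ hsub)
    have hg' : Integrable g (volume.restrict (Ioo a t)) :=
      hgi.mono_measure (Measure.restrict_mono_set _ hsub)
    have e1 := semigroup γ (1 - γ) a t hγ0 (by linarith) (by linarith) ht.1 v hv'
    have e2 := semigroup γ 1 a t hγ0 one_pos (by linarith) ht.1 g hg'
    have e3 := semigroup 1 γ a t one_pos hγ0 (by linarith) ht.1 g hg'
    rw [add_sub_cancel, rl_one] at e1
    rw [rl_one, add_comm, ← e2] at e3
    rw [← e1, e3]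
    apply rl_congr γ a b t _ _ ht hγ0.ne'
    filter_upwards [h] with s hs
    rw [hs, rl_one]
  have d1 := ((intervalIntegrable_iff_integrableOn_Ioo_of_le hab.le).2 hvi).ae_hasDerivAt_integral
  have d2 := ((intervalIntegrable_iff_integrableOn_Ioo_of_le hab.le).2 hwi).ae_hasDerivAt_integral
  rw [ae_restrict_iff' measurableSet_Ioo]
  filter_upwards [d1, d2] with t h1 h2 ht
  have htu : t ∈ uIcc a b := by rw [uIcc_of_le hab.le]; exact Ioo_subset_Icc_self ht
  refine (h1 htu a left_mem_uIcc).unique ((h2 htu a left_mem_uIcc).congr_of_eventuallyEq ?_)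
  filter_upwards [Ioo_mem_nhds ht.1 ht.2] with x hx
  exact key x hx
end
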